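/- arXiv:2110.04382 — 4 statements merged into one kernel-verified Lean document; each statement's English description precedes it below -/
import Mathlib

section
/- The DPK sequence (P_{𝓔_n})_{n ≥ 1} is a Cauchy sequence with respect to the total variation distance d_TV; consequently it converges in total variation to a probability measure P̃ on (Ω, F). -/
open MeasureTheory Finset
open scoped Classical

/-- Guarded conditional of a real-valued set function: `μ(A ∩ E)/μ(E)` when `μ(E) > 0`,
and `0` otherwise. -/
noncomputable def dpkCond {Ω : Type*} (μ : Set Ω → ℝ) (A E : Set Ω) : ℝ :=
  if 0 < μ E then μ (A ∩ E) / μ E else 0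

/-- The finite set of values of `𝒳` observed among the first `n` data points. -/
noncomputable def obsSet {𝒳 : Type*} (x : ℕ → 𝒳) (n : ℕ) : Finset 𝒳 :=
  (Finset.range n).image x

/-- The remainder set of the partition `𝓔_n`: the points of `Ω` whose `X`-value has not
been observed among the first `n` data points. -/
def dpkRem {Ω 𝒳 : Type*} (X : Ω → 𝒳) (x : ℕ → 𝒳) (n : ℕ) : Set Ω :=
  X ⁻¹' ((obsSet x n : Set 𝒳)ᶜ)

/-- The DPK sequence: `P_{𝓔_0} := P` and, for `n ≥ 1`,
`P_{𝓔_n}(A) := ∑_{E ∈ 𝓔_n, P_{𝓔_{n−1}}(E) > 0} (P_{𝓔_{n−1}}(A ∩ E)/P_{𝓔_{n−1}}(E)) · w_n(E)`,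
where `𝓔_n` consists of the sets `X⁻¹{x_j}` for the observed values `x_1, …, x_n` together
with the remainder, with weights `Q(X⁻¹{x_j})` and `1 − ∑_j Q(X⁻¹{x_j})` respectively. -/
noncomputable def dpkSeq {Ω 𝒳 : Type*} [MeasurableSpace Ω]
    (P Q : Measure Ω) (X : Ω → 𝒳) (x : ℕ → 𝒳) : ℕ → Set Ω → ℝ
  | 0 => fun A => (P A).toReal
  | n + 1 => fun A =>
      (∑ v ∈ obsSet x (n + 1),
        dpkCond (dpkSeq P Q X x n) A (X ⁻¹' {v}) * (Q (X ⁻¹' {v})).toReal)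
      + dpkCond (dpkSeq P Q X x n) A (dpkRem X x (n + 1))
          * (1 - ∑ v ∈ obsSet x (n + 1), (Q (X ⁻¹' {v})).toReal)

/-- Total variation distance between real-valued set functions:
`sup_{A ∈ F} |μ(A) − ν(A)|`. -/
noncomputable def dTVfun {Ω : Type*} [MeasurableSpace Ω] (μ ν : Set Ω → ℝ) : ℝ :=
  ⨆ A : {s : Set Ω // MeasurableSet s}, |μ A.1 - ν A.1|

section DPK

variable {Ω 𝒳 : Type*} {X : Ω → 𝒳} {x : ℕ → 𝒳}

lemma mem_dpkRem {n : ℕ} {ω : Ω} : ω ∈ dpkRem X x n ↔ X ω ∉ obsSet x n := by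
  simp [dpkRem]

lemma obsSet_mono : Monotone (obsSet x) := fun _ _ h =>
  Finset.image_subset_image (Finset.range_mono h)

lemma dpkRem_antitone : Antitone (dpkRem X x) := fun _ _ h _ hω =>
  mem_dpkRem.2 fun h' => mem_dpkRem.1 hω (obsSet_mono h h')

lemma dpkRem_eq_compl (n : ℕ) : dpkRem X x n = (⋃ v ∈ obsSet x n, X ⁻¹' {v})ᶜ := by
  ext ω
  simp [mem_dpkRem]

variable [MeasurableSpace Ω]

lemma dpkCond_eq_of_eq_mul {μ : Set Ω → ℝ} {P : Measure Ω} [IsFiniteMeasure P] {k : ℝ}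
    {A B : Set Ω} (h : ∀ C ⊆ B, μ C = k * P.real C) (hk : P.real B ≠ 0 → 0 < k) :
    dpkCond μ A B = P.real (A ∩ B) / P.real B := by
  rw [dpkCond, h _ Set.inter_subset_right, h B subset_rfl]
  by_cases hB : P.real B = 0
  · simp [hB]
  · have hBpos : 0 < P.real B := lt_of_le_of_ne measureReal_nonneg (Ne.symm hB)
    rw [if_pos (mul_pos (hk hB) hBpos), mul_div_mul_left _ _ (hk hB).ne']

lemma measurableSet_dpkRem (hX : ∀ v, MeasurableSet (X ⁻¹' {v})) (n : ℕ) :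
    MeasurableSet (dpkRem X x n) := by
  rw [dpkRem_eq_compl]
  exact (Finset.measurableSet_biUnion _ fun v _ => hX v).compl

lemma measureReal_eq_sum_add_dpkRem (μ : Measure Ω) [IsFiniteMeasure μ]
    (hX : ∀ v, MeasurableSet (X ⁻¹' {v})) (n : ℕ) {A : Set Ω} (hA : MeasurableSet A) :
    μ.real A = ∑ v ∈ obsSet x n, μ.real (A ∩ X ⁻¹' {v}) + μ.real (A ∩ dpkRem X x n) := by
  have hU : MeasurableSet (⋃ v ∈ obsSet x n, X ⁻¹' {v}) :=
    Finset.measurableSet_biUnion _ fun v _ => hX v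
  rw [← measureReal_inter_add_sdiff (s := A) hU, Set.inter_iUnion₂, measureReal_biUnion_finset,
    dpkRem_eq_compl, Set.sdiff_eq]
  · intro v _ w _ hvw
    exact (Disjoint.preimage X (Set.disjoint_singleton.2 hvw)).mono
      Set.inter_subset_right Set.inter_subset_right
  · exact fun v _ => hA.inter (hX v)

lemma measureReal_dpkRem (μ : Measure Ω) [IsProbabilityMeasure μ]
    (hX : ∀ v, MeasurableSet (X ⁻¹' {v})) (n : ℕ) :
    μ.real (dpkRem X x n) = 1 - ∑ v ∈ obsSet x n, μ.real (X ⁻¹' {v}) := by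
  have h := measureReal_eq_sum_add_dpkRem (x := x) μ hX n MeasurableSet.univ
  simp only [Set.univ_inter, probReal_univ] at h
  linarith

/-- Closed form of the DPK sequence: the prior conditioned on the cells of `𝓔_n`,
reweighted by `Q`. -/
noncomputable def dpkClosed (P Q : Measure Ω) (X : Ω → 𝒳) (x : ℕ → 𝒳) (n : ℕ) (A : Set Ω) : ℝ :=
  ∑ v ∈ obsSet x n, P.real (A ∩ X ⁻¹' {v}) / P.real (X ⁻¹' {v}) * Q.real (X ⁻¹' {v})
    + P.real (A ∩ dpkRem X x n) / P.real (dpkRem X x n) * Q.real (dpkRem X x n)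

lemma dpkClosed_of_subset_fiber (P Q : Measure Ω) {n : ℕ} {v : 𝒳} (hv : v ∈ obsSet x n)
    {C : Set Ω} (hC : C ⊆ X ⁻¹' {v}) :
    dpkClosed P Q X x n C = Q.real (X ⁻¹' {v}) / P.real (X ⁻¹' {v}) * P.real C := by
  have hR : C ∩ dpkRem X x n = ∅ := by
    rw [← Set.disjoint_iff_inter_eq_empty, Set.disjoint_left]
    intro ω hω hω'
    have : X ω = v := hC hω
    exact mem_dpkRem.1 hω' (this ▸ hv)
  rw [dpkClosed, Finset.sum_eq_single_of_mem v hv, hR, Set.inter_eq_left.2 hC]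
  · simp only [measureReal_empty]
    ring
  · intro w _ hw
    have : C ∩ X ⁻¹' {w} = ∅ := by
      rw [← Set.disjoint_iff_inter_eq_empty]
      exact (Disjoint.preimage X (Set.disjoint_singleton.2 hw.symm)).mono_left hC
    simp [this]

lemma dpkClosed_of_subset_dpkRem (P Q : Measure Ω) {n : ℕ} {C : Set Ω} (hC : C ⊆ dpkRem X x n) :
    dpkClosed P Q X x n C =
      Q.real (dpkRem X x n) / P.real (dpkRem X x n) * P.real C := by
  rw [dpkClosed, Finset.sum_eq_zero, Set.inter_eq_left.2 hC]
  · ring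
  · intro w hw
    have : C ∩ X ⁻¹' {w} = ∅ := by
      rw [← Set.disjoint_iff_inter_eq_empty, Set.disjoint_left]
      intro ω hω hω'
      have : X ω = w := hω'
      exact mem_dpkRem.1 (hC hω) (this ▸ hw)
    simp [this]

lemma measureReal_fiber_pos {μ : Measure Ω} [IsFiniteMeasure μ] (hμ : ∀ v, 0 < μ (X ⁻¹' {v}))
    (v : 𝒳) : 0 < μ.real (X ⁻¹' {v}) :=
  ENNReal.toReal_pos (hμ v).ne' (measure_ne_top _ _)

lemma measureReal_dpkRem_pos {μ : Measure Ω} [IsFiniteMeasure μ]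
    (hμ : ∀ v, 0 < μ (X ⁻¹' {v})) {n : ℕ} (hne : (dpkRem X x n).Nonempty) :
    0 < μ.real (dpkRem X x n) := by
  obtain ⟨ω, hω⟩ := hne
  refine (measureReal_fiber_pos hμ (X ω)).trans_le (measureReal_mono fun ω' hω' => ?_)
  have : X ω' = X ω := hω'
  exact mem_dpkRem.2 (this ▸ mem_dpkRem.1 hω)

lemma dpkCond_dpkClosed {P Q : Measure Ω} [IsFiniteMeasure P] [IsFiniteMeasure Q]
    (hP : ∀ v, 0 < P (X ⁻¹' {v})) (hQ : ∀ v, 0 < Q (X ⁻¹' {v})) {n : ℕ} {B : Set Ω}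
    (hB : (∃ v ∈ obsSet x n, B ⊆ X ⁻¹' {v}) ∨ B ⊆ dpkRem X x n) (A : Set Ω) :
    dpkCond (dpkClosed P Q X x n) A B = P.real (A ∩ B) / P.real B := by
  rcases hB with ⟨v, hv, hBv⟩ | hBR
  · exact dpkCond_eq_of_eq_mul (fun C hC => dpkClosed_of_subset_fiber P Q hv (hC.trans hBv))
      fun _ => div_pos (measureReal_fiber_pos hQ v) (measureReal_fiber_pos hP v)
  · refine dpkCond_eq_of_eq_mul (fun C hC => dpkClosed_of_subset_dpkRem P Q (hC.trans hBR))
      fun hB0 => ?_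
    have hne : (dpkRem X x n).Nonempty :=
      (nonempty_of_measureReal_ne_zero hB0).mono hBR
    exact div_pos (measureReal_dpkRem_pos hQ hne) (measureReal_dpkRem_pos hP hne)

lemma dpkSeq_eq_dpkClosed {P Q : Measure Ω} [IsProbabilityMeasure P] [IsProbabilityMeasure Q]
    (hX : ∀ v, MeasurableSet (X ⁻¹' {v}))
    (hP : ∀ v, 0 < P (X ⁻¹' {v})) (hQ : ∀ v, 0 < Q (X ⁻¹' {v})) (n : ℕ) :
    dpkSeq P Q X x n = dpkClosed P Q X x n := by
  induction n with
  | zero =>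
    funext A
    simp [dpkSeq, dpkClosed, obsSet, dpkRem, measureReal_def]
  | succ n ih =>
    funext A
    simp only [dpkSeq, ih, ← measureReal_def]
    rw [← measureReal_dpkRem Q hX, dpkClosed,
      dpkCond_dpkClosed hP hQ (Or.inr (dpkRem_antitone n.le_succ))]
    congr 1
    refine Finset.sum_congr rfl fun v _ => ?_
    rw [dpkCond_dpkClosed hP hQ]
    by_cases hv : v ∈ obsSet x n
    · exact Or.inl ⟨v, hv, subset_rfl⟩
    · refine Or.inr fun ω hω => mem_dpkRem.2 ?_
      have : X ω = v := hω
      exact this ▸ hv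

/-- The limit of the DPK sequence: the `Q`-mixture of the prior conditioned on the fibers. -/
noncomputable def dpkLimit (P Q : Measure Ω) (X : Ω → 𝒳) : Measure Ω :=
  Measure.sum fun v => Q (X ⁻¹' {v}) • ProbabilityTheory.cond P (X ⁻¹' {v})

lemma isProbabilityMeasure_dpkLimit [Countable 𝒳] {P Q : Measure Ω} [IsProbabilityMeasure P]
    [IsProbabilityMeasure Q] (hX : ∀ v, MeasurableSet (X ⁻¹' {v}))
    (hP : ∀ v, 0 < P (X ⁻¹' {v})) : IsProbabilityMeasure (dpkLimit P Q X) := by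
  refine ⟨?_⟩
  have hcond (v : 𝒳) : ProbabilityTheory.cond P (X ⁻¹' {v}) Set.univ = 1 :=
    (ProbabilityTheory.cond_isProbabilityMeasure (hP v).ne').measure_univ
  rw [dpkLimit, Measure.sum_apply _ MeasurableSet.univ]
  simp only [Measure.smul_apply, hcond, smul_eq_mul, mul_one]
  rw [← measure_iUnion _ hX, ← Set.preimage_iUnion, Set.iUnion_of_singleton, Set.preimage_univ,
    measure_univ]
  exact fun v w hvw => Disjoint.preimage X (Set.disjoint_singleton.2 hvw)

lemma dpkLimit_real_inter_fiber (P Q : Measure Ω) (hX : ∀ v, MeasurableSet (X ⁻¹' {v}))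
    {A : Set Ω} (hA : MeasurableSet A) (v : 𝒳) :
    (dpkLimit P Q X).real (A ∩ X ⁻¹' {v}) =
      P.real (A ∩ X ⁻¹' {v}) / P.real (X ⁻¹' {v}) * Q.real (X ⁻¹' {v}) := by
  rw [measureReal_def, dpkLimit, Measure.sum_apply _ (hA.inter (hX v)), tsum_eq_single v]
  · rw [Measure.smul_apply, ProbabilityTheory.cond_apply (hX v), Set.inter_comm A,
      ← Set.inter_assoc, Set.inter_self]
    simp only [smul_eq_mul, ENNReal.toReal_mul, ENNReal.toReal_inv, measureReal_def]
    ring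
  · intro w hw
    have : X ⁻¹' {w} ∩ (A ∩ X ⁻¹' {v}) = ∅ := by
      rw [← Set.disjoint_iff_inter_eq_empty]
      exact (Disjoint.preimage X (Set.disjoint_singleton.2 hw)).mono_right Set.inter_subset_right
    simp [ProbabilityTheory.cond_apply (hX w), this]

lemma dpkLimit_real_dpkRem [Countable 𝒳] {P Q : Measure Ω} [IsProbabilityMeasure P]
    [IsProbabilityMeasure Q] (hX : ∀ v, MeasurableSet (X ⁻¹' {v}))
    (hP : ∀ v, 0 < P (X ⁻¹' {v})) (n : ℕ) :
    (dpkLimit P Q X).real (dpkRem X x n) = Q.real (dpkRem X x n) := by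
  have := isProbabilityMeasure_dpkLimit (Q := Q) hX hP
  rw [measureReal_dpkRem _ hX, measureReal_dpkRem _ hX]
  congr 1
  refine Finset.sum_congr rfl fun v _ => ?_
  have h := dpkLimit_real_inter_fiber P Q hX MeasurableSet.univ v
  rwa [Set.univ_inter, div_self (measureReal_fiber_pos hP v).ne', one_mul] at h

lemma abs_dpkSeq_sub_dpkLimit_le [Countable 𝒳] {P Q : Measure Ω} [IsProbabilityMeasure P]
    [IsProbabilityMeasure Q] (hX : ∀ v, MeasurableSet (X ⁻¹' {v}))
    (hP : ∀ v, 0 < P (X ⁻¹' {v})) (hQ : ∀ v, 0 < Q (X ⁻¹' {v})) (n : ℕ)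
    {A : Set Ω} (hA : MeasurableSet A) :
    |dpkSeq P Q X x n A - (dpkLimit P Q X).real A| ≤ Q.real (dpkRem X x n) := by
  have := isProbabilityMeasure_dpkLimit (Q := Q) hX hP
  rw [dpkSeq_eq_dpkClosed hX hP hQ,
    measureReal_eq_sum_add_dpkRem (x := x) (dpkLimit P Q X) hX n hA, dpkClosed]
  simp only [dpkLimit_real_inter_fiber P Q hX hA, add_sub_add_left_eq_sub]
  refine abs_sub_le_of_nonneg_of_le (by positivity) ?_ measureReal_nonneg ?_
  · exact mul_le_of_le_one_left measureReal_nonneg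
      (div_le_one_of_le₀ (measureReal_mono Set.inter_subset_right) measureReal_nonneg)
  · rw [← dpkLimit_real_dpkRem hX hP]
    exact measureReal_mono Set.inter_subset_right

lemma tendsto_measureReal_dpkRem (Q : Measure Ω) [IsFiniteMeasure Q]
    (hX : ∀ v, MeasurableSet (X ⁻¹' {v})) (hx : Function.Surjective x) :
    Filter.Tendsto (fun n => Q.real (dpkRem X x n)) Filter.atTop (nhds 0) := by
  have hempty : ⋂ n, dpkRem X x n = ∅ := by
    refine Set.eq_empty_of_forall_notMem fun ω hω => ?_
    obtain ⟨i, hi⟩ := hx (X ω)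
    refine mem_dpkRem.1 (Set.mem_iInter.1 hω (i + 1)) ?_
    exact Finset.mem_image.2 ⟨i, Finset.self_mem_range_succ i, hi⟩
  have h := tendsto_measure_iInter_atTop (μ := Q)
    (fun n => (measurableSet_dpkRem (x := x) hX n).nullMeasurableSet) dpkRem_antitone
    ⟨0, measure_ne_top _ _⟩
  rw [hempty, measure_empty] at h
  exact (ENNReal.tendsto_toReal ENNReal.zero_ne_top).comp h

lemma dTVfun_le {μ ν : Set Ω → ℝ} {c : ℝ}
    (h : ∀ A, MeasurableSet A → |μ A - ν A| ≤ c) : dTVfun μ ν ≤ c :=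
  have : Nonempty {s : Set Ω // MeasurableSet s} := ⟨⟨∅, MeasurableSet.empty⟩⟩
  ciSup_le fun A => h A.1 A.2

lemma dTVfun_nonneg (μ ν : Set Ω → ℝ) : 0 ≤ dTVfun μ ν :=
  Real.iSup_nonneg fun _ => abs_nonneg _

end DPK

/-- the DPK sequence `(P_{𝓔_n})` is Cauchy with respect to the total
variation distance; consequently it converges in total variation to a probability measure
`P̃` on `(Ω, F)`. -/
theorem dpkSeq_cauchy_and_converges
    {Ω 𝒳 : Type*} [MeasurableSpace Ω] [Countable 𝒳] [Nonempty 𝒳]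
    (P Q : Measure Ω) [IsProbabilityMeasure P] [IsProbabilityMeasure Q]
    (X : Ω → 𝒳) (hXmeas : ∀ v : 𝒳, MeasurableSet (X ⁻¹' {v}))
    (hXsurj : Function.Surjective X)
    (hQpos : ∀ v : 𝒳, 0 < Q (X ⁻¹' {v}))
    (hPpos : ∀ v : 𝒳, 0 < P (X ⁻¹' {v}))
    (x : ℕ → 𝒳) (hxsurj : Function.Surjective x)
    (hxinj : ∀ i j : ℕ, i < j → x i = x j → ∀ v : 𝒳, ∃ k < j, x k = v) :
    (∀ ε : ℝ, 0 < ε → ∃ N : ℕ, ∀ n₁ n₂ : ℕ, N ≤ n₁ → N ≤ n₂ →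
      dTVfun (dpkSeq P Q X x n₁) (dpkSeq P Q X x n₂) < ε) ∧
    ∃ Pt : Measure Ω, IsProbabilityMeasure Pt ∧
      Filter.Tendsto
        (fun n => dTVfun (dpkSeq P Q X x n) (fun A => (Pt A).toReal))
        Filter.atTop (nhds 0) := by
  have hbound (n : ℕ) (A : Set Ω) (hA : MeasurableSet A) :=
    abs_dpkSeq_sub_dpkLimit_le (x := x) hXmeas hPpos hQpos n hA
  have hlim := tendsto_measureReal_dpkRem Q hXmeas hxsurj
  refine ⟨fun ε hε => ?_, dpkLimit P Q X, isProbabilityMeasure_dpkLimit hXmeas hPpos, ?_⟩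
  · obtain ⟨N, hN⟩ := Filter.eventually_atTop.1 (hlim.eventually_lt_const (half_pos hε))
    refine ⟨N, fun n₁ n₂ h₁ h₂ => ?_⟩
    refine (dTVfun_le (c := Q.real (dpkRem X x n₁) + Q.real (dpkRem X x n₂))
      fun A hA => ?_).trans_lt (by linarith [hN n₁ h₁, hN n₂ h₂])
    refine (abs_sub_le _ ((dpkLimit P Q X).real A) _).trans (add_le_add (hbound n₁ A hA) ?_)
    rw [abs_sub_comm]
    exact hbound n₂ A hA
  · exact squeeze_zero (fun _ => dTVfun_nonneg _ _) (fun n => dTVfun_le (hbound n)) hlim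
end

section
/- The lower and upper probabilities of the updated set 𝒫' are bounded by the generalized Bayes conditional probabilities: for every A ∈ F, 𝒫'_low(A) ≥ Σ_{j : E_j ≠ ∅} B_low(A|E_j) · q_j and 𝒫'_up(A) ≤ Σ_{j : E_j ≠ ∅} B_up(A|E_j) · q_j. -/
open MeasureTheory Finset
open scoped Classical

variable {Ω : Type*} [MeasurableSpace Ω]

/-- Lower probability of a set of probability measures: `𝒬_low(A) := inf_{P ∈ 𝒬} P(A)`. -/
noncomputable def lowProb (𝒮 : Set (Measure Ω)) (A : Set Ω) : ℝ :=
  ⨅ P : 𝒮, ((P : Measure Ω) A).toReal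

/-- Upper probability of a set of probability measures: `𝒬_up(A) := sup_{P ∈ 𝒬} P(A)`. -/
noncomputable def upProb (𝒮 : Set (Measure Ω)) (A : Set Ω) : ℝ :=
  ⨆ P : 𝒮, ((P : Measure Ω) A).toReal

/-- The Jeffrey (DPK) update of `P` with respect to the partition `E` and weights `q`:
`P'(A) := ∑_{j : E_j ≠ ∅} (P(A ∩ E_j)/P(E_j)) · q_j`. -/
noncomputable def jUpdate (P : Measure Ω) {m : ℕ} (E : Fin m → Set Ω)
    (q : Fin m → ℝ) (A : Set Ω) : ℝ :=
  ∑ j ∈ Finset.univ.filter (fun j => E j ≠ ∅),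
    ((P (A ∩ E j)).toReal / (P (E j)).toReal) * q j

/-- Lower probability of the updated set `𝒮' = {P' : P ∈ 𝒮}`. -/
noncomputable def jLow (𝒮 : Set (Measure Ω)) {m : ℕ} (E : Fin m → Set Ω)
    (q : Fin m → ℝ) (A : Set Ω) : ℝ :=
  ⨅ P : 𝒮, jUpdate (P : Measure Ω) E q A

/-- Upper probability of the updated set `𝒮' = {P' : P ∈ 𝒮}`. -/
noncomputable def jUp (𝒮 : Set (Measure Ω)) {m : ℕ} (E : Fin m → Set Ω)
    (q : Fin m → ℝ) (A : Set Ω) : ℝ :=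
  ⨆ P : 𝒮, jUpdate (P : Measure Ω) E q A

/-- Generalized Bayes conditional lower probability:
`B_low(A|B) := inf_{P ∈ 𝒮} P(A ∩ B)/P(B)`. -/
noncomputable def bayesLow (𝒮 : Set (Measure Ω)) (A B : Set Ω) : ℝ :=
  ⨅ P : 𝒮, ((P : Measure Ω) (A ∩ B)).toReal / ((P : Measure Ω) B).toReal

/-- Generalized Bayes conditional upper probability:
`B_up(A|B) := sup_{P ∈ 𝒮} P(A ∩ B)/P(B)`. -/
noncomputable def bayesUp (𝒮 : Set (Measure Ω)) (A B : Set Ω) : ℝ :=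
  ⨆ P : 𝒮, ((P : Measure Ω) (A ∩ B)).toReal / ((P : Measure Ω) B).toReal

/-- Geometric conditional lower probability: `G_low(A|B) := 𝒮_low(A ∩ B)/𝒮_low(B)`. -/
noncomputable def geomLow (𝒮 : Set (Measure Ω)) (A B : Set Ω) : ℝ :=
  lowProb 𝒮 (A ∩ B) / lowProb 𝒮 B

/-- Geometric conditional upper probability: `G_up(A|B) := 𝒮_up(A ∩ B)/𝒮_up(B)`. -/
noncomputable def geomUp (𝒮 : Set (Measure Ω)) (A B : Set Ω) : ℝ :=
  upProb 𝒮 (A ∩ B) / upProb 𝒮 B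

theorem toReal_inter_div_le_one (P : Measure Ω) [IsFiniteMeasure P] (A B : Set Ω) :
    (P (A ∩ B)).toReal / (P B).toReal ≤ 1 :=
  div_le_one_of_le₀
    (ENNReal.toReal_mono (measure_ne_top P B) (measure_mono Set.inter_subset_right))
    ENNReal.toReal_nonneg

theorem bayesLow_le (𝒮 : Set (Measure Ω)) (A B : Set Ω) (P : 𝒮) :
    bayesLow 𝒮 A B ≤ ((P : Measure Ω) (A ∩ B)).toReal / ((P : Measure Ω) B).toReal :=
  ciInf_le ⟨0, by rintro _ ⟨Q, rfl⟩; positivity⟩ P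

theorem le_bayesUp {𝒮 : Set (Measure Ω)} (h : ∀ P ∈ 𝒮, IsFiniteMeasure P) (A B : Set Ω)
    (P : 𝒮) :
    ((P : Measure Ω) (A ∩ B)).toReal / ((P : Measure Ω) B).toReal ≤ bayesUp 𝒮 A B := by
  refine le_ciSup (f := fun P : 𝒮 =>
    ((P : Measure Ω) (A ∩ B)).toReal / ((P : Measure Ω) B).toReal) ⟨1, ?_⟩ P
  rintro _ ⟨Q, rfl⟩
  have := h Q Q.2
  exact toReal_inter_div_le_one (Q : Measure Ω) A B

/-- the lower and upper probabilities of the updated set `𝒮'` are bounded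
by the generalized Bayes conditional probabilities: for every `A ∈ F`,
`𝒮'_low(A) ≥ ∑_{j : E_j ≠ ∅} B_low(A|E_j) · q_j` and
`𝒮'_up(A) ≤ ∑_{j : E_j ≠ ∅} B_up(A|E_j) · q_j`. -/
theorem jLow_ge_bayes_sum
    (𝒮 : Set (Measure Ω)) (h𝒮ne : 𝒮.Nonempty)
    (h𝒮prob : ∀ P ∈ 𝒮, IsProbabilityMeasure P)
    {m : ℕ} (E : Fin m → Set Ω) (hEmeas : ∀ j, MeasurableSet (E j))
    (hEdisj : Pairwise (Function.onFun Disjoint E))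
    (hEcover : (⋃ j, E j) = Set.univ)
    (q : Fin m → ℝ) (hq0 : ∀ j, 0 ≤ q j) (hq1 : ∑ j, q j = 1)
    (hqempty : ∀ j, E j = ∅ → q j = 0)
    (hpos : ∀ P ∈ 𝒮, ∀ j, E j ≠ ∅ → 0 < (P : Measure Ω) (E j))
    :
    ∀ A : Set Ω, MeasurableSet A →
      (∑ j ∈ Finset.univ.filter (fun j => E j ≠ ∅), bayesLow 𝒮 A (E j) * q j)
        ≤ jLow 𝒮 E q A ∧
      jUp 𝒮 E q A
        ≤ ∑ j ∈ Finset.univ.filter (fun j => E j ≠ ∅), bayesUp 𝒮 A (E j) * q j := by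
  intro A _
  have : Nonempty 𝒮 := h𝒮ne.to_subtype
  have hfin : ∀ P ∈ 𝒮, IsFiniteMeasure P := fun P hP =>
    have := h𝒮prob P hP
    inferInstance
  exact ⟨le_ciInf fun P => Finset.sum_le_sum fun j _ =>
      mul_le_mul_of_nonneg_right (bayesLow_le 𝒮 A (E j) P) (hq0 j),
    ciSup_le fun P => Finset.sum_le_sum fun j _ =>
      mul_le_mul_of_nonneg_right (le_bayesUp hfin A (E j) P) (hq0 j)⟩
end

section
/- Assume additionally that 𝒫_low(E_j) > 0 for every nonempty E_j. Then the geometric bounds are at least as tight as the generalized Bayes bounds: for every A ∈ F, Σ_{j : E_j ≠ ∅} G_low(A|E_j) · q_j ≥ Σ_{j : E_j ≠ ∅} B_low(A|E_j) · q_j and Σ_{j : E_j ≠ ∅} G_up(A|E_j) · q_j ≤ Σ_{j : E_j ≠ ∅} B_up(A|E_j) · q_j. -/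
open MeasureTheory Finset
open scoped Classical

variable {Ω : Type*} [MeasurableSpace Ω]

theorem bayesLow_le_geomLow {𝒮 : Set (Measure Ω)} (h𝒮 : 𝒮.Nonempty) {A B : Set Ω}
    (hlow : 0 < lowProb 𝒮 B) (hB : ∀ P ∈ 𝒮, 0 < (P B).toReal) :
    bayesLow 𝒮 A B ≤ geomLow 𝒮 A B := by
  have := h𝒮.to_subtype
  have hbayes : 0 ≤ bayesLow 𝒮 A B := Real.iInf_nonneg fun P => by positivity
  refine (le_div_iff₀ hlow).2 (le_ciInf fun P => ?_)
  have hP : bayesLow 𝒮 A B ≤ ((P : Measure Ω) (A ∩ B)).toReal / ((P : Measure Ω) B).toReal :=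
    ciInf_le ⟨0, Set.forall_mem_range.2 fun P => by positivity⟩ P
  have hPB : lowProb 𝒮 B ≤ ((P : Measure Ω) B).toReal :=
    ciInf_le ⟨0, Set.forall_mem_range.2 fun P => by positivity⟩ P
  exact (mul_le_mul_of_nonneg_left hPB hbayes).trans ((le_div_iff₀ (hB P P.2)).1 hP)

theorem geomUp_le_bayesUp {𝒮 : Set (Measure Ω)} (h𝒮 : 𝒮.Nonempty)
    (hprob : ∀ P ∈ 𝒮, IsProbabilityMeasure P) {A B : Set Ω}
    (hB : ∀ P ∈ 𝒮, 0 < (P B).toReal) :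
    geomUp 𝒮 A B ≤ bayesUp 𝒮 A B := by
  have := h𝒮.to_subtype
  have hbayes : 0 ≤ bayesUp 𝒮 A B := Real.iSup_nonneg fun P => by positivity
  have hPB (P : 𝒮) : ((P : Measure Ω) B).toReal ≤ upProb 𝒮 B :=
    le_ciSup (f := fun P : 𝒮 => ((P : Measure Ω) B).toReal)
      ⟨1, Set.forall_mem_range.2 fun P =>
        have := hprob P P.2
        measureReal_le_one⟩ P
  obtain ⟨P₀, hP₀⟩ := h𝒮
  have hup : 0 < upProb 𝒮 B := (hB P₀ hP₀).trans_le (hPB ⟨P₀, hP₀⟩)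
  refine (div_le_iff₀ hup).2 (ciSup_le fun P => ?_)
  have hP : ((P : Measure Ω) (A ∩ B)).toReal / ((P : Measure Ω) B).toReal ≤ bayesUp 𝒮 A B :=
    le_ciSup (f := fun P : 𝒮 => ((P : Measure Ω) (A ∩ B)).toReal / ((P : Measure Ω) B).toReal)
      ⟨1, Set.forall_mem_range.2 fun P =>
        have := hprob P P.2
        div_le_one_of_le₀ (measureReal_mono Set.inter_subset_right) ENNReal.toReal_nonneg⟩ P
  exact ((div_le_iff₀ (hB P P.2)).1 hP).trans (mul_le_mul_of_nonneg_left (hPB P) hbayes)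

/-- if additionally `𝒮_low(E_j) > 0` for every nonempty `E_j`, the
geometric bounds are at least as tight as the generalized Bayes bounds: for every `A ∈ F`,
`∑ G_low(A|E_j) q_j ≥ ∑ B_low(A|E_j) q_j` and `∑ G_up(A|E_j) q_j ≤ ∑ B_up(A|E_j) q_j`. -/
theorem geometric_bounds_tighter
    (𝒮 : Set (Measure Ω)) (h𝒮ne : 𝒮.Nonempty)
    (h𝒮prob : ∀ P ∈ 𝒮, IsProbabilityMeasure P)
    {m : ℕ} (E : Fin m → Set Ω) (hEmeas : ∀ j, MeasurableSet (E j))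
    (hEdisj : Pairwise (Function.onFun Disjoint E))
    (hEcover : (⋃ j, E j) = Set.univ)
    (q : Fin m → ℝ) (hq0 : ∀ j, 0 ≤ q j) (hq1 : ∑ j, q j = 1)
    (hqempty : ∀ j, E j = ∅ → q j = 0)
    (hpos : ∀ P ∈ 𝒮, ∀ j, E j ≠ ∅ → 0 < (P : Measure Ω) (E j))
    (hlowpos : ∀ j, E j ≠ ∅ → 0 < lowProb 𝒮 (E j)) :
    ∀ A : Set Ω, MeasurableSet A →
      (∑ j ∈ Finset.univ.filter (fun j => E j ≠ ∅), bayesLow 𝒮 A (E j) * q j)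
        ≤ ∑ j ∈ Finset.univ.filter (fun j => E j ≠ ∅), geomLow 𝒮 A (E j) * q j ∧
      (∑ j ∈ Finset.univ.filter (fun j => E j ≠ ∅), geomUp 𝒮 A (E j) * q j)
        ≤ ∑ j ∈ Finset.univ.filter (fun j => E j ≠ ∅), bayesUp 𝒮 A (E j) * q j := by
  intro A _
  have hE (j : Fin m) (hj : E j ≠ ∅) (P : Measure Ω) (hP : P ∈ 𝒮) : 0 < (P (E j)).toReal :=
    have := h𝒮prob P hP
    ENNReal.toReal_pos (hpos P hP j hj).ne' (measure_ne_top P _)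
  constructor <;> refine Finset.sum_le_sum fun j hj => mul_le_mul_of_nonneg_right ?_ (hq0 j)
  · have hj' := (Finset.mem_filter.1 hj).2
    exact bayesLow_le_geomLow h𝒮ne (hlowpos j hj') (hE j hj')
  · exact geomUp_le_bayesUp h𝒮ne h𝒮prob (hE j (Finset.mem_filter.1 hj).2)
end

section
/- Assume additionally that q_j > 0 and 𝒫_low(E_j) > 0 for every nonempty E_j, and that for every A ∈ F and every nonempty E_j one has 𝒫'_low(A ∩ E_j)/𝒫'_low(E_j) = 𝒫_low(A ∩ E_j)/𝒫_low(E_j) and 𝒫'_up(A ∩ E_j)/𝒫'_up(E_j) = 𝒫_up(A ∩ E_j)/𝒫_up(E_j). Then for every A ∈ F, 𝒫'_low(A) ≥ Σ_{j : E_j ≠ ∅} G_low(A|E_j) · q_j and 𝒫'_up(A) ≤ Σ_{j : E_j ≠ ∅} G_up(A|E_j) · q_j. (Note that every P' ∈ 𝒫' satisfies P'(E_j) = q_j, so 𝒫'_low(E_j) = 𝒫'_up(E_j) = q_j.) -/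
open MeasureTheory Finset
open scoped Classical

variable {Ω : Type*} [MeasurableSpace Ω]

theorem jUpdate_inter_cell (P : Measure Ω) {m : ℕ} (E : Fin m → Set Ω)
    (hEdisj : Pairwise (Function.onFun Disjoint E)) (q : Fin m → ℝ) (A : Set Ω)
    {j : Fin m} (hj : E j ≠ ∅) :
    jUpdate P E q (A ∩ E j) = (P (A ∩ E j)).toReal / (P (E j)).toReal * q j := by
  unfold jUpdate
  rw [Finset.sum_eq_single_of_mem j (by simpa using hj)]
  · rw [Set.inter_assoc, Set.inter_self]
  · intro i _ hij
    have hd : A ∩ E j ∩ E i = ∅ := by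
      rw [Set.inter_assoc, (hEdisj hij.symm).inter_eq, Set.inter_empty]
    simp [hd]

theorem jUpdate_cell (P : Measure Ω) [IsFiniteMeasure P] {m : ℕ} (E : Fin m → Set Ω)
    (hEdisj : Pairwise (Function.onFun Disjoint E)) (q : Fin m → ℝ)
    {j : Fin m} (hj : E j ≠ ∅) (hpos : 0 < P (E j)) :
    jUpdate P E q (E j) = q j := by
  have h := jUpdate_inter_cell P E hEdisj q Set.univ hj
  rw [Set.univ_inter] at h
  rw [h, div_self (ENNReal.toReal_pos hpos.ne' (measure_ne_top P _)).ne', one_mul]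

theorem jUpdate_eq_sum_inter_cell (P : Measure Ω) {m : ℕ} (E : Fin m → Set Ω)
    (hEdisj : Pairwise (Function.onFun Disjoint E)) (q : Fin m → ℝ) (A : Set Ω) :
    jUpdate P E q A =
      ∑ j ∈ Finset.univ.filter (fun j => E j ≠ ∅), jUpdate P E q (A ∩ E j) :=
  Finset.sum_congr rfl fun _ hj =>
    (jUpdate_inter_cell P E hEdisj q A (Finset.mem_filter.mp hj).2).symm

theorem jUpdate_nonneg (P : Measure Ω) {m : ℕ} (E : Fin m → Set Ω)
    {q : Fin m → ℝ} (hq0 : ∀ j, 0 ≤ q j) (A : Set Ω) : 0 ≤ jUpdate P E q A :=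
  Finset.sum_nonneg fun j _ =>
    mul_nonneg (div_nonneg ENNReal.toReal_nonneg ENNReal.toReal_nonneg) (hq0 j)

theorem jUpdate_le_sum (P : Measure Ω) [IsFiniteMeasure P] {m : ℕ} (E : Fin m → Set Ω)
    {q : Fin m → ℝ} (hq0 : ∀ j, 0 ≤ q j) (A : Set Ω) :
    jUpdate P E q A ≤ ∑ j ∈ Finset.univ.filter (fun j => E j ≠ ∅), q j :=
  Finset.sum_le_sum fun j _ => mul_le_of_le_one_left (hq0 j) <|
    div_le_one_of_le₀
      (ENNReal.toReal_mono (measure_ne_top P _) (measure_mono Set.inter_subset_right))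
      ENNReal.toReal_nonneg

/-- assume additionally `q_j > 0` and `𝒮_low(E_j) > 0` for every nonempty
`E_j`, and that the relative lower (and upper) probabilities of `A ∩ E_j` with respect to
`E_j` are unchanged by the update. Then for every `A ∈ F`,
`𝒮'_low(A) ≥ ∑_{j : E_j ≠ ∅} G_low(A|E_j) · q_j` and
`𝒮'_up(A) ≤ ∑_{j : E_j ≠ ∅} G_up(A|E_j) · q_j`. -/
theorem jLow_ge_geometric_sum_of_stable
    (𝒮 : Set (Measure Ω)) (h𝒮ne : 𝒮.Nonempty)
    (h𝒮prob : ∀ P ∈ 𝒮, IsProbabilityMeasure P)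
    {m : ℕ} (E : Fin m → Set Ω) (hEmeas : ∀ j, MeasurableSet (E j))
    (hEdisj : Pairwise (Function.onFun Disjoint E))
    (hEcover : (⋃ j, E j) = Set.univ)
    (q : Fin m → ℝ) (hq0 : ∀ j, 0 ≤ q j) (hq1 : ∑ j, q j = 1)
    (hqempty : ∀ j, E j = ∅ → q j = 0)
    (hpos : ∀ P ∈ 𝒮, ∀ j, E j ≠ ∅ → 0 < (P : Measure Ω) (E j))
    (hqpos : ∀ j, E j ≠ ∅ → 0 < q j)
    (hlowpos : ∀ j, E j ≠ ∅ → 0 < lowProb 𝒮 (E j))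
    (hstabLow : ∀ A : Set Ω, MeasurableSet A → ∀ j, E j ≠ ∅ →
      jLow 𝒮 E q (A ∩ E j) / jLow 𝒮 E q (E j)
        = lowProb 𝒮 (A ∩ E j) / lowProb 𝒮 (E j))
    (hstabUp : ∀ A : Set Ω, MeasurableSet A → ∀ j, E j ≠ ∅ →
      jUp 𝒮 E q (A ∩ E j) / jUp 𝒮 E q (E j)
        = upProb 𝒮 (A ∩ E j) / upProb 𝒮 (E j)) :
    ∀ A : Set Ω, MeasurableSet A →
      (∑ j ∈ Finset.univ.filter (fun j => E j ≠ ∅), geomLow 𝒮 A (E j) * q j)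
        ≤ jLow 𝒮 E q A ∧
      jUp 𝒮 E q A
        ≤ ∑ j ∈ Finset.univ.filter (fun j => E j ≠ ∅), geomUp 𝒮 A (E j) * q j := by
  intro A hA
  have : Nonempty 𝒮 := h𝒮ne.to_subtype
  have hprob (P : 𝒮) : IsProbabilityMeasure (P : Measure Ω) := h𝒮prob P P.2
  have hcell (P : 𝒮) (j) (hj : E j ≠ ∅) : jUpdate (P : Measure Ω) E q (E j) = q j :=
    jUpdate_cell _ E hEdisj q hj (hpos P P.2 j hj)
  have hlow (j) (hj : E j ≠ ∅) : geomLow 𝒮 A (E j) * q j = jLow 𝒮 E q (A ∩ E j) := by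
    have hqj : jLow 𝒮 E q (E j) = q j := by simp [jLow, hcell _ j hj]
    rw [geomLow, ← hstabLow A hA j hj, hqj, div_mul_cancel₀ _ (hqpos j hj).ne']
  have hup (j) (hj : E j ≠ ∅) : geomUp 𝒮 A (E j) * q j = jUp 𝒮 E q (A ∩ E j) := by
    have hqj : jUp 𝒮 E q (E j) = q j := by simp [jUp, hcell _ j hj]
    rw [geomUp, ← hstabUp A hA j hj, hqj, div_mul_cancel₀ _ (hqpos j hj).ne']
  constructor
  · refine le_ciInf fun P => ?_
    rw [jUpdate_eq_sum_inter_cell _ E hEdisj]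
    refine Finset.sum_le_sum fun j hj => ?_
    rw [hlow j (Finset.mem_filter.mp hj).2]
    exact ciInf_le ⟨0, Set.forall_mem_range.mpr fun P : 𝒮 => jUpdate_nonneg _ E hq0 _⟩ P
  · refine ciSup_le fun P => ?_
    rw [jUpdate_eq_sum_inter_cell _ E hEdisj]
    refine Finset.sum_le_sum fun j hj => ?_
    rw [hup j (Finset.mem_filter.mp hj).2]
    exact le_ciSup (f := fun P : 𝒮 => jUpdate (P : Measure Ω) E q (A ∩ E j))
      ⟨_, Set.forall_mem_range.mpr fun P : 𝒮 => jUpdate_le_sum _ E hq0 _⟩ P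
end
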